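/- Let J and M be 3×3 real diagonal matrices with positive diagonal entries. On ℝ³×ℝ³ define the inner product ⟨(a,b),(c,d)⟩ = (Ja)·c + (Mb)·d and the bilinear map ∇_{(a,b)}(c,d) = ( ½(a×c + J⁻¹(a×(Jc) + b×(Md) + c×(Ja) + d×(Mb))), ½(b×c + a×d + M⁻¹(a×(Md) + c×(Mb))) ). Then ∇ satisfies the Koszul-type identity characterizing the restriction to 𝔰𝔢(3) of the Levi-Civita connection of the associated left-invariant metric on SE(3): for all v, z, u ∈ ℝ³×ℝ³, ⟨∇_v z, u⟩ = ½( ⟨[v,z],u⟩ − ⟨z,[v,u]⟩ − ⟨v,[z,u]⟩ ). -/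

import Mathlib

open Matrix

/-- The Lie bracket of `𝔰𝔢(3)` in twist coordinates:
`[(a,b),(c,d)] = (a×c, a×d − c×b)`. -/
def se3Bracket (v z : (Fin 3 → ℝ) × (Fin 3 → ℝ)) : (Fin 3 → ℝ) × (Fin 3 → ℝ) :=
  (crossProduct v.1 z.1, crossProduct v.1 z.2 - crossProduct z.1 v.2)

/-- The inner product on `𝔰𝔢(3) ≅ ℝ³ × ℝ³` determined by diagonal matrices `J`, `M`:
`⟨(a,b),(c,d)⟩ = (Ja)·c + (Mb)·d`. -/
def se3Inner (J M : Matrix (Fin 3) (Fin 3) ℝ)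
    (v z : (Fin 3 → ℝ) × (Fin 3 → ℝ)) : ℝ :=
  J.mulVec v.1 ⬝ᵥ z.1 + M.mulVec v.2 ⬝ᵥ z.2

/-- The restriction to `𝔰𝔢(3)` of the Levi-Civita connection of the left-invariant
metric on `SE(3)` determined by `J`, `M`. -/
noncomputable def se3Nabla (J M : Matrix (Fin 3) (Fin 3) ℝ)
    (v z : (Fin 3 → ℝ) × (Fin 3 → ℝ)) : (Fin 3 → ℝ) × (Fin 3 → ℝ) :=
  ((1 / 2 : ℝ) • (crossProduct v.1 z.1 +
      J⁻¹.mulVec (crossProduct v.1 (J.mulVec z.1) + crossProduct v.2 (M.mulVec z.2) +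
        crossProduct z.1 (J.mulVec v.1) + crossProduct z.2 (M.mulVec v.2))),
   (1 / 2 : ℝ) • (crossProduct v.2 z.1 + crossProduct v.1 z.2 +
      M⁻¹.mulVec (crossProduct v.1 (M.mulVec z.2) + crossProduct z.1 (M.mulVec v.2))))

/-- The connection `∇` on `𝔰𝔢(3)` satisfies the Koszul-type identity characterizing the
restriction to the Lie algebra of the Levi-Civita connection of the associated
left-invariant metric on `SE(3)`. -/
theorem se3_nabla_koszul (j m : Fin 3 → ℝ) (hj : ∀ i, 0 < j i) (hm : ∀ i, 0 < m i)
    (v z u : (Fin 3 → ℝ) × (Fin 3 → ℝ)) :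
    se3Inner (Matrix.diagonal j) (Matrix.diagonal m)
        (se3Nabla (Matrix.diagonal j) (Matrix.diagonal m) v z) u =
      (1 / 2 : ℝ) *
        (se3Inner (Matrix.diagonal j) (Matrix.diagonal m) (se3Bracket v z) u -
          se3Inner (Matrix.diagonal j) (Matrix.diagonal m) z (se3Bracket v u) -
          se3Inner (Matrix.diagonal j) (Matrix.diagonal m) v (se3Bracket z u)) := by
  have diagonal_mul_inv {k : Fin 3 → ℝ} (hk : ∀ i, 0 < k i) :
      diagonal k * (diagonal k)⁻¹ = 1 := by
    refine mul_nonsing_inv _ ?_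
    rw [det_diagonal]
    exact (Finset.prod_pos fun i _ => hk i).ne'.isUnit
  simp only [se3Inner, se3Nabla, se3Bracket, mulVec_smul, mulVec_add, mulVec_mulVec,
    diagonal_mul_inv hj, diagonal_mul_inv hm, one_mulVec]
  simp only [dotProduct, Fin.sum_univ_three, cross_apply, mulVec_diagonal, Pi.add_apply,
    Pi.sub_apply, Pi.smul_apply, smul_eq_mul, cons_val]
  ring
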